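/- arXiv:2402.11256 — 2 statements merged into one kernel-verified Lean document; each statement's English description precedes it below -/
import Mathlib

section
/- Let F be a finite field with n elements and R = M₂(F). Define the graph I(R) on the nontrivial idempotents of R (idempotents other than 0 and 1), where e and f are adjacent iff e ≠ f and ef = fe = 0. Then I(R) is a perfect matching: it is a disjoint union of n(n+1)/2 copies of K₂. -/
theorem Matrix.isNontrivialIdempotent_fin_two_iff {F : Type*} [Field F]
    (A : Matrix (Fin 2) (Fin 2) F) :
    (A * A = A ∧ A ≠ 0 ∧ A ≠ 1) ↔
      A 1 1 = 1 - A 0 0 ∧ A 0 1 * A 1 0 = A 0 0 * (1 - A 0 0) := by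
  simp only [ne_eq, ← Matrix.ext_iff, Fin.forall_fin_two, Matrix.mul_apply, Fin.sum_univ_two,
    Matrix.zero_apply, Matrix.one_apply_eq, Matrix.one_apply_ne (zero_ne_one' (Fin 2)),
    Matrix.one_apply_ne (zero_ne_one' (Fin 2)).symm]
  generalize A 0 0 = a, A 0 1 = b, A 1 0 = c, A 1 1 = d
  constructor
  · rintro ⟨⟨⟨h00, h01⟩, h10, h11⟩, hA0, hA1⟩
    have hd : d = 1 - a := by
      by_contra hne
      have hs : a + d - 1 ≠ 0 := fun h => hne (by linear_combination h)
      have hb : b = 0 := (mul_eq_zero.mp (show (a + d - 1) * b = 0 by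
        linear_combination h01)).resolve_left hs
      have hc : c = 0 := (mul_eq_zero.mp (show (a + d - 1) * c = 0 by
        linear_combination h10)).resolve_left hs
      subst hb hc
      have had : a = d := sub_eq_zero.mp ((mul_eq_zero.mp (show (a + d - 1) * (a - d) = 0 by
        linear_combination h00 - h11)).resolve_left hs)
      subst had
      rcases mul_eq_zero.mp (show a * (a - 1) = 0 by linear_combination h00) with h | h
      · exact hA0 ⟨⟨h, rfl⟩, rfl, h⟩
      · exact hA1 ⟨⟨sub_eq_zero.mp h, rfl⟩, rfl, sub_eq_zero.mp h⟩
    exact ⟨hd, by linear_combination h00⟩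
  · rintro ⟨rfl, h⟩
    refine ⟨⟨⟨by linear_combination h, by ring⟩, by ring, by linear_combination h⟩, ?_, ?_⟩
    · rintro ⟨⟨h0, -⟩, -, h1⟩
      exact one_ne_zero (α := F) (by linear_combination h0 + h1)
    · rintro ⟨⟨h0, -⟩, -, h1⟩
      exact one_ne_zero (α := F) (by linear_combination - h0 - h1)

theorem Matrix.eq_one_sub_of_mul_eq_zero_of_isNontrivialIdempotent {F : Type*} [Field F]
    {A B : Matrix (Fin 2) (Fin 2) F} (hA : A * A = A ∧ A ≠ 0 ∧ A ≠ 1)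
    (hB : B * B = B ∧ B ≠ 0 ∧ B ≠ 1) (hAB : A * B = 0) (hBA : B * A = 0) : B = 1 - A := by
  by_contra hne
  have hC : (1 - A - B) * (1 - A - B) = 1 - A - B ∧ 1 - A - B ≠ 0 ∧ 1 - A - B ≠ 1 := by
    refine ⟨?_, fun h => hne (sub_eq_zero.mp h).symm, fun h => hA.2.1 ?_⟩
    · have : (1 - A - B) * (1 - A - B) =
          1 - A - B - A + A * A + A * B - B + B * A + B * B := by noncomm_ring
      rw [this, hAB, hBA, hA.1, hB.1]
      abel
    · have h' : A * (1 - A - B) = A := by rw [h, mul_one]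
      rw [mul_sub, mul_sub, mul_one, hA.1, hAB, sub_self, sub_zero] at h'
      exact h'.symm
  have h₁ := ((Matrix.isNontrivialIdempotent_fin_two_iff A).mp hA).1
  have h₂ := ((Matrix.isNontrivialIdempotent_fin_two_iff B).mp hB).1
  have h₃ := ((Matrix.isNontrivialIdempotent_fin_two_iff _).mp hC).1
  simp only [Matrix.sub_apply, Matrix.one_apply_eq] at h₃
  exact one_ne_zero (α := F) (by linear_combination - h₃ - h₁ - h₂)

/-- The nontrivial idempotent with the given first row, if its off-diagonal entry is nonzero, or
the lower triangular one with the given diagonal and lower left entry. -/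
def Matrix.nontrivialIdempotentOfParam {F : Type*} [Field F] :
    F × Fˣ ⊕ Bool × F → Matrix (Fin 2) (Fin 2) F
  | .inl (a, b) => !![a, b; a * (1 - a) / b, 1 - a]
  | .inr (true, c) => !![1, 0; c, 0]
  | .inr (false, c) => !![0, 0; c, 1]

theorem Matrix.nontrivialIdempotentOfParam_injective {F : Type*} [Field F] :
    Function.Injective (Matrix.nontrivialIdempotentOfParam (F := F)) := by
  rintro (⟨a, b⟩ | ⟨_ | _, c⟩) (⟨a', b'⟩ | ⟨_ | _, c'⟩) h <;>
    have h00 := congr_fun₂ h 0 0 <;> have h01 := congr_fun₂ h 0 1 <;>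
    have h10 := congr_fun₂ h 1 0 <;> clear h <;>
    simp [Matrix.nontrivialIdempotentOfParam] at h00 h01 h10 ⊢
  · exact ⟨h00, Units.ext h01⟩
  · exact b'.ne_zero h01.symm
  · exact h10
  · exact b'.ne_zero h01.symm
  · exact h10

theorem Matrix.range_nontrivialIdempotentOfParam {F : Type*} [Field F] :
    Set.range (Matrix.nontrivialIdempotentOfParam (F := F)) =
      {A | A * A = A ∧ A ≠ 0 ∧ A ≠ 1} := by
  ext A
  rw [Set.mem_ofPred_eq, Matrix.isNontrivialIdempotent_fin_two_iff]
  constructor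
  · rintro ⟨⟨a, b⟩ | ⟨_ | _, c⟩, rfl⟩ <;> simp [Matrix.nontrivialIdempotentOfParam]
    field_simp
  · rintro ⟨hd, h⟩
    rw [Matrix.eta_fin_two A, hd]
    by_cases hb : A 0 1 = 0
    · rw [hb, zero_mul] at h
      rcases mul_eq_zero.mp h.symm with ha | ha
      · exact ⟨.inr (false, A 1 0), by simp [Matrix.nontrivialIdempotentOfParam, ha, hb]⟩
      · have ha' : A 0 0 = 1 := (sub_eq_zero.mp ha).symm
        exact ⟨.inr (true, A 1 0), by simp [Matrix.nontrivialIdempotentOfParam, ha', hb]⟩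
    · refine ⟨.inl (A 0 0, Units.mk0 _ hb), ?_⟩
      simp only [Matrix.nontrivialIdempotentOfParam, Units.val_mk0]
      rw [← h, mul_div_cancel_left₀ _ hb]

theorem Matrix.card_nontrivialIdempotent_fin_two (F : Type*) [Field F] [Fintype F] :
    Nat.card {A : Matrix (Fin 2) (Fin 2) F // A * A = A ∧ A ≠ 0 ∧ A ≠ 1} =
      Fintype.card F * (Fintype.card F + 1) := by
  classical
  have h := Nat.card_range_of_injective (Matrix.nontrivialIdempotentOfParam_injective (F := F))
  rw [Matrix.range_nontrivialIdempotentOfParam] at h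
  refine h.trans ?_
  rw [Nat.card_eq_fintype_card, Fintype.card_sum, Fintype.card_prod, Fintype.card_prod,
    Fintype.card_units, Fintype.card_bool]
  obtain ⟨m, hm⟩ := Nat.exists_eq_succ_of_ne_zero (Fintype.card_ne_zero (α := F))
  rw [hm, Nat.succ_sub_one, Nat.succ_eq_add_one]
  ring

theorem stmt_11 (F : Type*) [Field F] [Fintype F] (n : ℕ) (hn : Fintype.card F = n)
    (G : SimpleGraph {A : Matrix (Fin 2) (Fin 2) F // A * A = A ∧ A ≠ 0 ∧ A ≠ 1})
    (hG : ∀ e f, G.Adj e f ↔ e ≠ f ∧ (e : Matrix (Fin 2) (Fin 2) F) * f = 0 ∧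
      (f : Matrix (Fin 2) (Fin 2) F) * e = 0) :
    (∀ v, ∃! w, G.Adj v w) ∧
      Nat.card {A : Matrix (Fin 2) (Fin 2) F // A * A = A ∧ A ≠ 0 ∧ A ≠ 1} =
        2 * (n * (n + 1) / 2) := by
  refine ⟨?_, ?_⟩
  · rintro ⟨A, hA⟩
    have hmul : A * (1 - A) = 0 := by rw [mul_sub, mul_one, hA.1, sub_self]
    have hmul' : (1 - A) * A = 0 := by rw [sub_mul, one_mul, hA.1, sub_self]
    refine ⟨⟨1 - A, ?_, fun h => hA.2.2 (sub_eq_zero.mp h).symm,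
      fun h => hA.2.1 (sub_eq_self.mp h)⟩, (hG _ _).mpr ⟨fun h => ?_, hmul, hmul'⟩, ?_⟩
    · rw [mul_sub, mul_one, hmul', sub_zero]
    · rw [← Subtype.mk.inj h, hA.1] at hmul
      exact hA.2.1 hmul
    · rintro ⟨B, hB⟩ h
      obtain ⟨-, hAB, hBA⟩ := (hG _ _).mp h
      exact Subtype.ext
        (Matrix.eq_one_sub_of_mul_eq_zero_of_isNontrivialIdempotent hA hB hAB hBA)
  · rw [Matrix.card_nontrivialIdempotent_fin_two, hn,
      Nat.two_mul_div_two_of_even (Nat.even_mul_succ_self n)]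
end

section
/- Let F be a finite field and R = M₂(F). Define the graph G on the nontrivial idempotents of R where distinct e, f are adjacent iff ef = 0 or fe = 0. Then G is connected and has diameter 2. -/
open Matrix in
theorem Matrix.mul_mul_self_eq_trace_smul_of_det_eq_zero_fin_two {R : Type*} [CommRing R]
    {P : Matrix (Fin 2) (Fin 2) R} (hP : P.det = 0) (X : Matrix (Fin 2) (Fin 2) R) :
    P * X * P = (P * X).trace • P := by
  rw [det_fin_two] at hP
  ext i j
  fin_cases i <;> fin_cases j <;> simp [mul_apply, trace_fin_two, Fin.sum_univ_two]
  · linear_combination (-X 1 1) * hP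
  · linear_combination (X 0 1) * hP
  · linear_combination (X 1 0) * hP
  · linear_combination (-X 0 0) * hP

open Matrix in
theorem Matrix.det_eq_zero_and_trace_eq_one_of_mul_self_fin_two {F : Type*} [Field F]
    {A : Matrix (Fin 2) (Fin 2) F} (hA : A * A = A) (h0 : A ≠ 0) (h1 : A ≠ 1) :
    A.det = 0 ∧ A.trace = 1 := by
  have hdet : A.det = 0 := by
    by_contra h
    exact h1 <| ((A.isUnit_iff_isUnit_det).2 (isUnit_iff_ne_zero.2 h)).mul_left_cancel
      (by rw [hA, mul_one])
  refine ⟨hdet, ?_⟩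
  have hch : A * A = A.trace • A := by
    simpa using mul_mul_self_eq_trace_smul_of_det_eq_zero_fin_two hdet 1
  have h : (1 - A.trace) • A = 0 := by rw [sub_smul, one_smul, ← hch, hA, sub_self]
  exact (sub_eq_zero.1 ((smul_eq_zero.1 h).resolve_right h0)).symm

open Matrix in
theorem Matrix.mul_eq_zero_or_mul_eq_zero_of_trace_mul_eq_zero_fin_two {R : Type*} [CommRing R]
    [IsDomain R] {A B : Matrix (Fin 2) (Fin 2) R} (hA : A.det = 0) (hB : B.det = 0)
    (h : (A * B).trace = 0) : A * B = 0 ∨ B * A = 0 := by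
  have key : ∀ i j k l, (A * B) i j * (B * A) k l = 0 := by
    rw [det_fin_two] at hA hB
    have hswap : ∀ {M : Matrix (Fin 2) (Fin 2) R}, M 0 0 * M 1 1 - M 0 1 * M 1 0 = 0 →
        ∀ i j k l, M i j * M k l = M i l * M k j := by
      intro M hM i j k l
      fin_cases i <;> fin_cases j <;> fin_cases k <;> fin_cases l <;> simp <;> grind
    intro i j k l
    calc (A * B) i j * (B * A) k l
        = ∑ a, ∑ b, (A i a * A b l) * (B a j * B k b) := by
          simp only [mul_apply, Finset.sum_mul_sum]
          exact Finset.sum_congr rfl fun a _ => Finset.sum_congr rfl fun b _ => by ring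
      _ = ∑ a, ∑ b, (A i l * B k j) * (A b a * B a b) := by
          refine Finset.sum_congr rfl fun a _ => Finset.sum_congr rfl fun b _ => ?_
          rw [hswap hA i a b l, hswap hB a j k b]
          ring
      _ = (A i l * B k j) * (A * B).trace := by
          simp only [trace, diag_apply, mul_apply, Finset.mul_sum]
          exact Finset.sum_comm
      _ = 0 := by rw [h, mul_zero]
  by_contra! hne
  obtain ⟨⟨i, j, hij⟩, k, l, hkl⟩ :
      (∃ i j, (A * B) i j ≠ 0) ∧ ∃ k l, (B * A) k l ≠ 0 := by
    constructor <;> by_contra! hz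
    · exact hne.1 (Matrix.ext hz)
    · exact hne.2 (Matrix.ext hz)
  exact mul_ne_zero hij hkl (key i j k l)

open Matrix in
/-- If `e`, `f` are nontrivial idempotents with `e * f ≠ 0` and `f * e ≠ 0`, the idempotent with
image `ker e` and kernel `im f` is annihilated by `e` on the left and by `f` on the right. -/
theorem Matrix.exists_idempotent_mul_eq_zero_fin_two {F : Type*} [Field F]
    {e f : Matrix (Fin 2) (Fin 2) F} (he : e * e = e ∧ e ≠ 0 ∧ e ≠ 1)
    (hf : f * f = f ∧ f ≠ 0 ∧ f ≠ 1) (hef : e * f ≠ 0) (hfe : f * e ≠ 0) :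
    ∃ g, (g * g = g ∧ g ≠ 0 ∧ g ≠ 1) ∧ e * g = 0 ∧ g * f = 0 := by
  obtain ⟨hde, hte⟩ := det_eq_zero_and_trace_eq_one_of_mul_self_fin_two he.1 he.2.1 he.2.2
  obtain ⟨hdf, htf⟩ := det_eq_zero_and_trace_eq_one_of_mul_self_fin_two hf.1 hf.2.1 hf.2.2
  set t := (e * f).trace with ht
  have ht0 : t ≠ 0 := fun h =>
    (mul_eq_zero_or_mul_eq_zero_of_trace_mul_eq_zero_fin_two hde hdf h).elim hef hfe
  have htr : ((1 - e) * (1 - f)).trace = t := by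
    have : (1 - e) * (1 - f) = 1 - e - f + e * f := by noncomm_ring
    rw [this, trace_add, trace_sub, trace_sub, hte, htf, trace_one, ← ht]
    simp only [Fintype.card_fin, Nat.cast_ofNat]
    ring
  have hd : (1 - e).det = 0 := by
    rw [det_fin_two] at hde ⊢
    rw [trace_fin_two] at hte
    simp
    linear_combination hde - hte
  have hsq : (1 - e) * (1 - f) * ((1 - e) * (1 - f)) = t • ((1 - e) * (1 - f)) := by
    rw [← mul_assoc, mul_mul_self_eq_trace_smul_of_det_eq_zero_fin_two hd, htr, smul_mul_assoc]
  have heg : e * (t⁻¹ • ((1 - e) * (1 - f))) = 0 := by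
    rw [mul_smul_comm, ← mul_assoc, mul_one_sub e e, he.1, sub_self, zero_mul, smul_zero]
  have hgf : t⁻¹ • ((1 - e) * (1 - f)) * f = 0 := by
    rw [smul_mul_assoc, mul_assoc, one_sub_mul f f, hf.1, sub_self, mul_zero, smul_zero]
  refine ⟨t⁻¹ • ((1 - e) * (1 - f)), ⟨?_, ?_, ?_⟩, heg, hgf⟩
  · rw [smul_mul_smul_comm, hsq, smul_smul, mul_assoc, inv_mul_cancel₀ ht0, mul_one]
  · intro h
    have := congrArg trace h
    rw [trace_smul, htr, smul_eq_mul, inv_mul_cancel₀ ht0, trace_zero] at this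
    exact one_ne_zero this
  · intro h
    rw [h, mul_one] at heg
    exact he.2.1 heg

theorem stmt_13 (F : Type*) [Field F] [Fintype F]
    (G : SimpleGraph {A : Matrix (Fin 2) (Fin 2) F // A * A = A ∧ A ≠ 0 ∧ A ≠ 1})
    (hG : ∀ e f, G.Adj e f ↔ e ≠ f ∧ ((e : Matrix (Fin 2) (Fin 2) F) * f = 0 ∨
      (f : Matrix (Fin 2) (Fin 2) F) * e = 0)) :
    G.Connected ∧ (∀ u v, G.dist u v ≤ 2) ∧ (∃ u v, G.dist u v = 2) := by
  have hwalk : ∀ u v, ∃ p : G.Walk u v, p.length ≤ 2 := by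
    intro u v
    by_cases huv : u = v
    · subst huv
      exact ⟨.nil, by simp⟩
    by_cases hadj : G.Adj u v
    · exact ⟨hadj.toWalk, by simp⟩
    rw [hG, not_and, not_or] at hadj
    obtain ⟨h₁, h₂⟩ := hadj huv
    obtain ⟨g, hg, hug, hgv⟩ := Matrix.exists_idempotent_mul_eq_zero_fin_two u.2 v.2 h₁ h₂
    have hu : G.Adj u ⟨g, hg⟩ := (hG _ _).2 ⟨by
      rintro rfl
      exact hg.2.1 (hg.1.symm.trans hug), Or.inl hug⟩
    have hv : G.Adj ⟨g, hg⟩ v := (hG _ _).2 ⟨by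
      rintro rfl
      exact hg.2.1 (hg.1.symm.trans hgv), Or.inl hgv⟩
    exact ⟨.cons hu (.cons hv .nil), by simp⟩
  have hdist : ∀ u v, G.dist u v ≤ 2 := fun u v =>
    let ⟨p, hp⟩ := hwalk u v
    (SimpleGraph.dist_le p).trans hp
  let e : {A : Matrix (Fin 2) (Fin 2) F // A * A = A ∧ A ≠ 0 ∧ A ≠ 1} :=
    ⟨!![1, 0; 0, 0], by ext i j; fin_cases i <;> fin_cases j <;> simp, fun h => by simpa using congrFun₂ h 0 0,
      fun h => by simpa using congrFun₂ h 1 1⟩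
  let f : {A : Matrix (Fin 2) (Fin 2) F // A * A = A ∧ A ≠ 0 ∧ A ≠ 1} :=
    ⟨!![1, 1; 0, 0], by ext i j; fin_cases i <;> fin_cases j <;> simp, fun h => by simpa using congrFun₂ h 0 0,
      fun h => by simpa using congrFun₂ h 1 1⟩
  have hconn : G.Connected :=
    { preconnected := fun u v => (hwalk u v).elim fun p _ => ⟨p⟩
      nonempty := ⟨e⟩ }
  refine ⟨hconn, hdist, e, f, ?_⟩
  have hne : e ≠ f := fun h => by simpa [e, f] using congrFun₂ (congrArg Subtype.val h) 0 1
  have hnadj : ¬ G.Adj e f := by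
    rw [hG]
    rintro ⟨-, h | h⟩ <;> simpa [e, f] using congrFun₂ h 0 0
  have h₀ : G.dist e f ≠ 0 := fun h => hne (hconn.dist_eq_zero_iff.1 h)
  have h₁ : G.dist e f ≠ 1 := fun h => hnadj (SimpleGraph.dist_eq_one_iff_adj.1 h)
  have h₂ := hdist e f
  omega
end
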